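/- Let i = √−1 ∈ ℂ and let c be a nonempty list of integers with every entry ≥ 2. Then: (1) 𝓢(c)(i) = 0 if s(c) ≡ 0 (mod 4); 𝓢(c)(i) ∈ {1+i, −(1+i), 1−i, −(1−i)} if s(c) ≡ 2 (mod 4); 𝓢(c)(i) ∈ {1, −1, i, −i} if s(c) is odd; and analogously 𝓡(c)(i) = 0 if r(c) ≡ 0 (mod 4); 𝓡(c)(i) ∈ {±(1+i), ±(1−i)} if r(c) ≡ 2 (mod 4); 𝓡(c)(i) ∈ {±1, ±i} if r(c) is odd. (2) r(c) ≡ s(c) (mod 4) if and only if 𝓡(c)(i) = 𝓢(c)(i). -/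

import Mathlib

open Polynomial

/-- The `q`-deformation `[n]_q = 1 + q + ⋯ + q^{n-1}` of a nonnegative integer. -/
noncomputable def qNat (n : ℕ) : Polynomial ℤ := (Finset.range n).sum fun i => X ^ i

/-- The matrix `M_q⁻(c) = (([c]_q, -q^{c-1}), (1, 0))` over `ℤ[q]`. -/
noncomputable def MqNeg (c : ℕ) : Matrix (Fin 2) (Fin 2) (Polynomial ℤ) :=
  !![qNat c, -(X ^ (c - 1)); 1, 0]

/-- `𝓡(c)`: the (0,0) entry of `M_q⁻(c₁)⋯M_q⁻(c_l)`. -/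
noncomputable def Rpoly (L : List ℕ) : Polynomial ℤ := ((L.map MqNeg).prod) 0 0

/-- `𝓢(c)`: the (1,0) entry of `M_q⁻(c₁)⋯M_q⁻(c_l)`. -/
noncomputable def Spoly (L : List ℕ) : Polynomial ℤ := ((L.map MqNeg).prod) 1 0

/-- `r(c) = 𝓡(c)(1)`. -/
noncomputable def rNum (L : List ℕ) : ℤ := (Rpoly L).eval 1

/-- `s(c) = 𝓢(c)(1)`. -/
noncomputable def sNum (L : List ℕ) : ℤ := (Spoly L).eval 1

/-- The possible values `(x, y)` at `q = i` of a pair of `q`-deformed numerator and denominator,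
in terms of the residues `(r, s)` modulo 4 of the classical ones; the values are determined up to
a fourth root of unity `u`. -/
inductive ValuesAtI : ZMod 4 → ZMod 4 → ℂ → ℂ → Prop
  | den_zero (r : ZMod 4) (u : ℂ) (hr : r = 1 ∨ r = 3) (hu : u ^ 4 = 1) : ValuesAtI r 0 u 0
  | num_zero (s : ZMod 4) (u : ℂ) (hs : s = 1 ∨ s = 3) (hu : u ^ 4 = 1) : ValuesAtI 0 s 0 u
  | same (r : ZMod 4) (u : ℂ) (hr : r = 1 ∨ r = 3) (hu : u ^ 4 = 1) : ValuesAtI r r u u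
  | opposite (r : ZMod 4) (u : ℂ) (hr : r = 1 ∨ r = 3) (hu : u ^ 4 = 1) :
      ValuesAtI r (-r) u (-Complex.I * u)
  | num_two (s : ZMod 4) (u : ℂ) (hs : s = 1 ∨ s = 3) (hu : u ^ 4 = 1) :
      ValuesAtI 2 s ((1 + Complex.I) * u) u
  | den_two (r : ZMod 4) (u : ℂ) (hr : r = 1 ∨ r = 3) (hu : u ^ 4 = 1) :
      ValuesAtI r 2 u ((1 - Complex.I) * u)

namespace ValuesAtI

variable {r s : ZMod 4} {x y : ℂ}

/-- The action of `((q, 1), (0, 1))`. -/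
theorem translate (h : ValuesAtI r s x y) : ValuesAtI (r + s) s (Complex.I * x + y) y := by
  have hI : Complex.I * Complex.I = -1 := Complex.I_mul_I
  have hI4 : Complex.I ^ 4 = 1 := Complex.I_pow_four
  induction h with
  | den_zero r u hr hu =>
    convert den_zero r (Complex.I * u) hr (by rw [mul_pow, hI4, hu, one_mul]) using 1 <;> ring
  | num_zero s u hs hu => convert same s u hs hu using 1 <;> ring
  | same r u hr hu =>
    convert num_two r u hr hu using 1
    · rcases hr with rfl | rfl <;> decide
    · ring
  | opposite r u hr hu =>
    convert num_zero (-r) (-Complex.I * u) (by rcases hr with rfl | rfl <;> decide)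
      (by rw [mul_pow, neg_pow, hI4, hu]; norm_num) using 1 <;> ring
  | num_two s u hs hu =>
    convert opposite (-s) (Complex.I * u) (by rcases hs with rfl | rfl <;> decide)
      (by rw [mul_pow, hI4, hu, one_mul]) using 1
    · rcases hs with rfl | rfl <;> decide
    · ring
    · linear_combination u * hI
    · linear_combination u * hI
  | den_two r u hr hu =>
    convert den_two (r + 2) u (by rcases hr with rfl | rfl <;> decide) hu using 1
    ring

/-- The action of `((1, -1), (1, 0))`. -/
theorem rotate (h : ValuesAtI r s x y) : ValuesAtI (r - s) r (x - y) x := by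
  have hI : Complex.I * Complex.I = -1 := Complex.I_mul_I
  have hI4 : Complex.I ^ 4 = 1 := Complex.I_pow_four
  induction h with
  | den_zero r u hr hu => convert same r u hr hu using 1 <;> ring
  | num_zero s u hs hu =>
    convert den_zero (-s) (-u) (by rcases hs with rfl | rfl <;> decide)
      (by rw [neg_pow, hu]; norm_num) using 1 <;> ring
  | same r u hr hu => convert num_zero r u hr hu using 1 <;> ring
  | opposite r u hr hu =>
    convert num_two r u hr hu using 1
    · rcases hr with rfl | rfl <;> decide
    · ring
  | num_two s u hs hu =>
    convert den_two s (Complex.I * u) hs (by rw [mul_pow, hI4, hu, one_mul]) using 1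
    · rcases hs with rfl | rfl <;> decide
    · ring
    · linear_combination u * hI
  | den_two r u hr hu =>
    convert opposite (-r) (Complex.I * u) (by rcases hr with rfl | rfl <;> decide)
      (by rw [mul_pow, hI4, hu, one_mul]) using 1
    · rcases hr with rfl | rfl <;> decide
    · ring
    · ring
    · linear_combination u * hI

/-- The action of `M_q⁻(n + 1)`. -/
theorem cons (h : ValuesAtI r s x y) (n : ℕ) :
    ValuesAtI (((n + 1 : ℕ) : ZMod 4) * r - s) r
      ((∑ j ∈ Finset.range (n + 1), Complex.I ^ j) * x - Complex.I ^ n * y) x := by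
  induction n with
  | zero => simpa using h.rotate
  | succ n ih =>
    convert ih.translate using 1
    · push_cast; ring
    · rw [geom_sum_succ (n := n + 1)]; ring

end ValuesAtI

theorem Rpoly_cons (c : ℕ) (L : List ℕ) :
    Rpoly (c :: L) = qNat c * Rpoly L - X ^ (c - 1) * Spoly L := by
  simp [Rpoly, Spoly, MqNeg, Matrix.mul_apply, sub_eq_add_neg]

theorem Spoly_cons (c : ℕ) (L : List ℕ) : Spoly (c :: L) = Rpoly L := by
  simp [Rpoly, Spoly, MqNeg, Matrix.mul_apply]

theorem valuesAtI_aeval (L : List ℕ) (hL : ∀ c ∈ L, 1 ≤ c) :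
    ValuesAtI (rNum L) (sNum L) (aeval Complex.I (Rpoly L)) (aeval Complex.I (Spoly L)) := by
  induction L with
  | nil => simpa [rNum, sNum, Rpoly, Spoly] using ValuesAtI.den_zero 1 1 (Or.inl rfl) (one_pow 4)
  | cons c L ih =>
    obtain ⟨n, rfl⟩ := Nat.exists_eq_add_of_le' (hL c (by simp))
    have h := (ih fun d hd => hL d (by simp [hd])).cons n
    simpa [rNum, sNum, Rpoly_cons, Spoly_cons, qNat, eval_finsetSum] using h

theorem eq_of_pow_four_eq_one {u : ℂ} (hu : u ^ 4 = 1) :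
    u = 1 ∨ u = -1 ∨ u = Complex.I ∨ u = -Complex.I := by
  have h : (u - 1) * ((u + 1) * ((u - Complex.I) * (u + Complex.I))) = 0 := by
    linear_combination hu - (u ^ 2 - 1) * Complex.I_mul_I
  simpa [sub_eq_zero, add_eq_zero_iff_eq_neg] using h

/-- The allowed values at `q = i` of a single polynomial whose value at `q = 1` is `r` modulo 4. -/
inductive ValueAtI : ZMod 4 → ℂ → Prop
  | zero : ValueAtI 0 0
  | two (u : ℂ) (hu : u ^ 4 = 1) : ValueAtI 2 ((1 + Complex.I) * u)
  | odd (r : ZMod 4) (u : ℂ) (hr : r = 1 ∨ r = 3) (hu : u ^ 4 = 1) : ValueAtI r u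

namespace ValuesAtI

variable {r s : ZMod 4} {x y : ℂ}

theorem num (h : ValuesAtI r s x y) : ValueAtI r x := by
  induction h with
  | num_zero => exact .zero
  | num_two s u hs hu => exact .two u hu
  | _ => exact .odd _ _ ‹_› ‹_›

theorem den (h : ValuesAtI r s x y) : ValueAtI s y := by
  induction h with
  | den_zero => exact .zero
  | den_two r u hr hu =>
    convert ValueAtI.two (-Complex.I * u)
      (by rw [mul_pow, neg_pow, Complex.I_pow_four, hu]; norm_num) using 1
    linear_combination u * Complex.I_mul_I
  | opposite r u hr hu =>
    exact .odd _ _ (by rcases hr with rfl | rfl <;> decide)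
      (by rw [mul_pow, neg_pow, Complex.I_pow_four, hu]; norm_num)
  | _ => exact .odd _ _ ‹_› ‹_›

theorem num_eq_den_iff (h : ValuesAtI r s x y) : r = s ↔ x = y := by
  have ne_zero {u : ℂ} (hu : u ^ 4 = 1) : u ≠ 0 := by rintro rfl; norm_num at hu
  induction h with
  | den_zero r u hr hu =>
    exact iff_of_false (by rcases hr with rfl | rfl <;> decide) (ne_zero hu)
  | num_zero s u hs hu =>
    exact iff_of_false (by rcases hs with rfl | rfl <;> decide) (ne_zero hu).symm
  | same => simp
  | opposite r u hr hu =>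
    refine iff_of_false (by rcases hr with rfl | rfl <;> decide) fun h => ?_
    have := mul_right_cancel₀ (ne_zero hu) ((one_mul u).trans h)
    simpa using congrArg Complex.re this
  | num_two s u hs hu =>
    refine iff_of_false (by rcases hs with rfl | rfl <;> decide) fun h => ?_
    have := mul_right_cancel₀ (ne_zero hu) (h.trans (one_mul u).symm)
    simpa using congrArg Complex.im this
  | den_two r u hr hu =>
    refine iff_of_false (by rcases hr with rfl | rfl <;> decide) fun h => ?_
    have := mul_right_cancel₀ (ne_zero hu) ((one_mul u).trans h)
    simpa using congrArg Complex.im this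

end ValuesAtI

theorem ValueAtI.classification {n : ℤ} {x : ℂ} (h : ValueAtI n x) :
    (n ≡ 0 [ZMOD 4] → x = 0) ∧
    (n ≡ 2 [ZMOD 4] →
      x ∈ ({1 + Complex.I, -(1 + Complex.I), 1 - Complex.I, -(1 - Complex.I)} : Set ℂ)) ∧
    (Odd n → x ∈ ({1, -1, Complex.I, -Complex.I} : Set ℂ)) := by
  have hmod (m : ℤ) : n ≡ m [ZMOD 4] ↔ (n : ZMod 4) = m := (ZMod.intCast_eq_intCast_iff n m 4).symm
  have hodd : Odd n → (n : ZMod 4) = 1 ∨ (n : ZMod 4) = 3 := fun hn => by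
    have h1 := hmod 1
    have h3 := hmod 3
    push_cast at h1 h3
    rw [← h1, ← h3, Int.ModEq, Int.ModEq]
    rw [Int.odd_iff] at hn
    omega
  rw [hmod, hmod]
  push_cast
  generalize (n : ZMod 4) = r at h hodd
  refine ⟨fun hr => ?_, fun hr => ?_, fun hn => ?_⟩
  · cases h with
    | zero => rfl
    | two => exact absurd hr (by decide)
    | odd _ _ h' => subst hr; exact absurd h' (by decide)
  · cases h with
    | zero => exact absurd hr (by decide)
    | two u hu =>
      have hI : Complex.I * Complex.I = -1 := Complex.I_mul_I
      simp only [Set.mem_insert_iff, Set.mem_singleton_iff]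
      rcases eq_of_pow_four_eq_one hu with rfl | rfl | rfl | rfl
      · exact .inl (mul_one _)
      · exact .inr (.inl (by ring))
      · exact .inr (.inr (.inr (by linear_combination hI)))
      · exact .inr (.inr (.inl (by linear_combination -hI)))
    | odd _ _ h' => subst hr; exact absurd h' (by decide)
  · cases h with
    | zero => exact absurd (hodd hn) (by decide)
    | two => exact absurd (hodd hn) (by decide)
    | odd _ _ _ hu => simpa using eq_of_pow_four_eq_one hu

/-- Values of `𝓢(L)` and `𝓡(L)` at `q = i` according to the residues of `s(L)` and `r(L)`
mod 4, and: `r(L) ≡ s(L) (mod 4)` iff `𝓡(L)(i) = 𝓢(L)(i)`. -/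
theorem stmt17 (L : List ℕ) (hL : L ≠ []) (hL2 : ∀ y ∈ L, 2 ≤ y) :
    ((sNum L ≡ 0 [ZMOD 4] → (Polynomial.aeval Complex.I) (Spoly L) = 0) ∧
     (sNum L ≡ 2 [ZMOD 4] → (Polynomial.aeval Complex.I) (Spoly L) ∈
        ({1 + Complex.I, -(1 + Complex.I), 1 - Complex.I, -(1 - Complex.I)} : Set ℂ)) ∧
     (Odd (sNum L) → (Polynomial.aeval Complex.I) (Spoly L) ∈
        ({1, -1, Complex.I, -Complex.I} : Set ℂ)) ∧
     (rNum L ≡ 0 [ZMOD 4] → (Polynomial.aeval Complex.I) (Rpoly L) = 0) ∧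
     (rNum L ≡ 2 [ZMOD 4] → (Polynomial.aeval Complex.I) (Rpoly L) ∈
        ({1 + Complex.I, -(1 + Complex.I), 1 - Complex.I, -(1 - Complex.I)} : Set ℂ)) ∧
     (Odd (rNum L) → (Polynomial.aeval Complex.I) (Rpoly L) ∈
        ({1, -1, Complex.I, -Complex.I} : Set ℂ))) ∧
    (rNum L ≡ sNum L [ZMOD 4] ↔
      (Polynomial.aeval Complex.I) (Rpoly L) = (Polynomial.aeval Complex.I) (Spoly L)) := by
  have h := valuesAtI_aeval L fun c hc => one_le_two.trans (hL2 c hc)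
  obtain ⟨s0, s2, s1⟩ := h.den.classification
  obtain ⟨r0, r2, r1⟩ := h.num.classification
  exact ⟨⟨s0, s2, s1, r0, r2, r1⟩,
    (ZMod.intCast_eq_intCast_iff _ _ 4).symm.trans h.num_eq_den_iff⟩
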